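/- Let d ≥ 1, let H₁ : ℝ^{2d} → ℝ be smooth, and let φ : ℝ × ℝ^{2d} → ℝ^{2d} be a smooth map with φ(0, x) = x and ∂φ/∂t(t,x) = X_{H₁}(φ(t,x)) for all (t,x) (the Hamiltonian flow of H₁), and assume each time-t map φ(t, ·) preserves ω₀ (ω₀(D_xφ(t,x)u, D_xφ(t,x)v) = ω₀(u,v) for all x, u, v). Define ψ : ℝ^{2d} × ℝ × ℝ → ℝ^{2d} × ℝ × ℝ by ψ(x, θ, μ) = (φ(θ, x), θ, μ − H₁(x)). Then: (i) ψ is a diffeomorphism; (ii) ψ is a symplectomorphism for the product form Ω, i.e. Ω(Dψ(z)ξ, Dψ(z)η) = Ω(ξ, η) for every z, ξ, η; and (iii) J̃ ∘ ψ = Φ, where J̃(x,θ,μ) := H₁(x) + μ and Φ(x,θ,μ) := μ; equivalently H₁(φ(θ,x)) + μ − H₁(x) = μ for all (x,θ,μ). (This is the Lemma inside the proof of Proposition 2.3 of the paper, stated with Q = (ℝ^{2d}, ω₀) and the universal cover ℝ² of T*S¹.) -/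

import Mathlib

noncomputable section

open Set

/-- Phase space `ℝ^{2d}`, written as pairs `(p, q)` with `p q : Fin d → ℝ`. -/
abbrev Phase (d : ℕ) := (Fin d → ℝ) × (Fin d → ℝ)

/-- The standard symplectic form `ω₀` on `ℝ^{2d}`:
`ω₀(u,v) = ∑ i, (u_i v_{d+i} - u_{d+i} v_i)`. -/
def omega0 {d : ℕ} (u v : Phase d) : ℝ :=
  ∑ i, (u.1 i * v.2 i - u.2 i * v.1 i)

/-- The Hamiltonian vector field `X_H` of `H`, characterized by
`ω₀(X_H(x), v) = DH(x) v` for all `v`. -/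
def hamVF {d : ℕ} (H : Phase d → ℝ) (x : Phase d) : Phase d :=
  (fun i => fderiv ℝ H x (0, Pi.single i 1),
   fun i => - fderiv ℝ H x (Pi.single i 1, 0))

/-- `γ` is a `T`-periodic orbit of `X_H`. -/
def IsPeriodicOrbit {d : ℕ} (H : Phase d → ℝ) (γ : ℝ → Phase d) (T : ℝ) : Prop :=
  (∀ t, HasDerivAt γ (hamVF H (γ t)) t) ∧ (∀ t, γ (t + T) = γ t)

/-- `H` is pre-admissible supported in `U`, with maximum value `m`:
`0 ≤ H ≤ m`, `H ≡ 0` on some nonempty open subset of `U`, and `H ≡ m`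
outside some compact subset of `U`. -/
def PreAdmissible {d : ℕ} (H : Phase d → ℝ) (U : Set (Phase d)) (m : ℝ) : Prop :=
  ContDiff ℝ (⊤ : ℕ∞) H ∧ (∀ x, 0 ≤ H x ∧ H x ≤ m) ∧
  (∃ V : Set (Phase d), IsOpen V ∧ V.Nonempty ∧ V ⊆ U ∧ ∀ x ∈ V, H x = 0) ∧
  (∃ K : Set (Phase d), IsCompact K ∧ K ⊆ U ∧ ∀ x ∉ K, H x = m)

/-- A free Hamiltonian circle action of period 1 on the open set `N`,
generated by `H₁`. -/
def FreeHamCircleAction {d : ℕ} (N : Set (Phase d)) (H₁ : Phase d → ℝ)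
    (φ : ℝ → Phase d → Phase d) : Prop :=
  ContDiffOn ℝ (⊤ : ℕ∞) (fun p : ℝ × Phase d => φ p.1 p.2) (Set.univ ×ˢ N) ∧
  (∀ t, ∀ x ∈ N, φ t x ∈ N) ∧
  (∀ x ∈ N, φ 0 x = x) ∧
  (∀ s t, ∀ x ∈ N, φ s (φ t x) = φ (s + t) x) ∧
  (∀ t, ∀ x ∈ N, φ (t + 1) x = φ t x) ∧
  (∀ t, ∀ x ∈ N, HasDerivAt (fun s => φ s x) (hamVF H₁ (φ t x)) t) ∧
  (∀ t, ∀ x ∈ N, φ t x = x → ∃ j : ℤ, t = (j : ℝ))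

/-- The product symplectic form `Ω = ω₀ ⊕ ω₀^{ℝ²}` on `ℝ^{2d} × ℝ × ℝ`
(coordinates `(x, θ, μ)`): `Ω((u,a,b),(v,c,e)) = ω₀(u,v) + a·e − b·c`. -/
def OmegaP {d : ℕ} (ξ η : Phase d × ℝ × ℝ) : ℝ :=
  omega0 ξ.1 η.1 + ξ.2.1 * η.2.2 - ξ.2.2 * η.2.1

/-- Uniqueness of global integral curves of a `C¹` vector field. -/
theorem ode_unique_aux {E : Type*} [NormedAddCommGroup E] [NormedSpace ℝ E] {v : E → E}
    (hv : ContDiff ℝ 1 v) {f g : ℝ → E} (hf : ∀ t, HasDerivAt f (v (f t)) t)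
    (hg : ∀ t, HasDerivAt g (v (g t)) t) (h0 : f 0 = g 0) : f = g := by
  have hfc : Continuous f := continuous_iff_continuousAt.2 fun t => (hf t).continuousAt
  have hgc : Continuous g := continuous_iff_continuousAt.2 fun t => (hg t).continuousAt
  have hcl : IsClopen {t | f t = g t} := by
    refine ⟨isClosed_eq hfc hgc, isOpen_iff_mem_nhds.2 fun t ht => ?_⟩
    obtain ⟨K, s, hs, hK⟩ := hv.contDiffAt.exists_lipschitzOnWith (x := f t)
    have ht' : f t = g t := ht
    have h1 : ∀ᶠ r in nhds t, f r ∈ s := hfc.continuousAt.eventually_mem hs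
    have h2 : ∀ᶠ r in nhds t, g r ∈ s := hgc.continuousAt.eventually_mem (ht' ▸ hs)
    exact ODE_solution_unique_of_eventually (v := fun _ => v) (s := fun _ => s) (K := K)
      (Filter.Eventually.of_forall fun _ => hK)
      (h1.mono fun r hr => ⟨hf r, hr⟩) (h2.mono fun r hr => ⟨hg r, hr⟩) ht'
  have := hcl.eq_univ ⟨0, h0⟩
  funext t
  exact (this.symm ▸ Set.mem_univ t : t ∈ {t | f t = g t})

theorem omega0_hamVF {d : ℕ} (H : Phase d → ℝ) (x v : Phase d) :
    omega0 (hamVF H x) v = fderiv ℝ H x v := by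
  obtain ⟨p, q⟩ := v
  have h : ((p, q) : Phase d) = ∑ i, (p i • ((Pi.single i 1, 0) : Phase d)
      + q i • ((0, Pi.single i 1) : Phase d)) := by
    ext j <;> simp [Prod.fst_sum, Prod.snd_sum, Finset.sum_apply, Pi.single_apply]
  conv_rhs => rw [h]
  simp only [map_sum, map_add, map_smul, smul_eq_mul]
  unfold omega0 hamVF
  refine Finset.sum_congr rfl fun i _ => ?_
  ring

theorem omega0_swap {d : ℕ} (u v : Phase d) : omega0 u v = - omega0 v u := by
  unfold omega0
  rw [← Finset.sum_neg_distrib]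
  refine Finset.sum_congr rfl fun i _ => ?_
  ring

theorem omega0_add_left {d : ℕ} (u u' v : Phase d) :
    omega0 (u + u') v = omega0 u v + omega0 u' v := by
  unfold omega0
  rw [← Finset.sum_add_distrib]
  refine Finset.sum_congr rfl fun i _ => ?_
  simp only [Prod.fst_add, Prod.snd_add, Pi.add_apply]
  ring

theorem omega0_smul_left {d : ℕ} (a : ℝ) (u v : Phase d) :
    omega0 (a • u) v = a * omega0 u v := by
  unfold omega0
  rw [Finset.mul_sum]
  refine Finset.sum_congr rfl fun i _ => ?_
  simp only [Prod.smul_fst, Prod.smul_snd, Pi.smul_apply, smul_eq_mul]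
  ring

theorem contDiff_hamVF {d : ℕ} {H : Phase d → ℝ} (hH : ContDiff ℝ (⊤ : ℕ∞) H) :
    ContDiff ℝ 1 (hamVF H) := by
  have h : ContDiff ℝ 1 (fderiv ℝ H) := hH.fderiv_right (by norm_cast)
  unfold hamVF
  refine ContDiff.prodMk (contDiff_pi.2 fun i => ?_) (contDiff_pi.2 fun i => ?_)
  · exact h.clm_apply contDiff_const
  · exact (h.clm_apply contDiff_const).neg

/-- the Lemma inside the proof of Proposition 2.3 of the
paper, with `Q = (ℝ^{2d}, ω₀)` and the universal cover `ℝ²` of `T*S¹`: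
if `φ` is the Hamiltonian flow of `H₁` and each time-`t` map preserves `ω₀`,
then `ψ(x,θ,μ) = (φ(θ,x), θ, μ − H₁(x))` is a symplectomorphism of
`(ℝ^{2d} × ℝ × ℝ, Ω)` and `J̃ ∘ ψ = Φ`, where `J̃(x,θ,μ) = H₁(x) + μ` and
`Φ(x,θ,μ) = μ`. -/
theorem stmt6 {d : ℕ} (hd : 1 ≤ d)
    {H₁ : Phase d → ℝ} (hH₁ : ContDiff ℝ (⊤ : ℕ∞) H₁)
    {φ : ℝ → Phase d → Phase d}
    (hφsmooth : ContDiff ℝ (⊤ : ℕ∞) (fun p : ℝ × Phase d => φ p.1 p.2))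
    (hφ0 : ∀ x, φ 0 x = x)
    (hφode : ∀ t x, HasDerivAt (fun s => φ s x) (hamVF H₁ (φ t x)) t)
    (hφsymp : ∀ t x u v, omega0 (fderiv ℝ (φ t) x u) (fderiv ℝ (φ t) x v) = omega0 u v)
    (ψ : Phase d × ℝ × ℝ → Phase d × ℝ × ℝ)
    (hψ : ∀ (x : Phase d) (θ μ : ℝ), ψ (x, θ, μ) = (φ θ x, θ, μ - H₁ x)) :
    -- (i) ψ is a diffeomorphism
    (Function.Bijective ψ ∧ ContDiff ℝ (⊤ : ℕ∞) ψ ∧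
      ∃ ψinv : Phase d × ℝ × ℝ → Phase d × ℝ × ℝ, ContDiff ℝ (⊤ : ℕ∞) ψinv ∧
        Function.LeftInverse ψinv ψ ∧ Function.RightInverse ψinv ψ) ∧
    -- (ii) ψ preserves Ω
    (∀ z ξ η, OmegaP (fderiv ℝ ψ z ξ) (fderiv ℝ ψ z η) = OmegaP ξ η) ∧
    -- (iii) J̃ ∘ ψ = Φ
    (∀ z : Phase d × ℝ × ℝ, H₁ (ψ z).1 + (ψ z).2.2 = z.2.2) ∧
    (∀ (x : Phase d) (θ μ : ℝ), H₁ (φ θ x) + μ - H₁ x = μ) := by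
  have hne : ((⊤ : ℕ∞) : WithTop ℕ∞) ≠ 0 := by simp
  have hHd : Differentiable ℝ H₁ := hH₁.differentiable hne
  have hφd : Differentiable ℝ (fun p : ℝ × Phase d => φ p.1 p.2) := hφsmooth.differentiable hne
  -- energy conservation
  have hE : ∀ t x, H₁ (φ t x) = H₁ x := by
    intro t x
    have hd' : ∀ s, HasDerivAt (fun s => H₁ (φ s x)) 0 s := by
      intro s
      have h := (hHd (φ s x)).hasFDerivAt.comp_hasDerivAt s (hφode s x)
      have h0 : fderiv ℝ H₁ (φ s x) (hamVF H₁ (φ s x)) = 0 := by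
        rw [← omega0_hamVF]
        have := omega0_swap (hamVF H₁ (φ s x)) (hamVF H₁ (φ s x))
        linarith
      rw [h0] at h
      exact h
    have h := is_const_of_deriv_eq_zero (fun s => (hd' s).differentiableAt)
      (fun s => (hd' s).deriv) t 0
    simpa [hφ0] using h
  -- group law
  have hgrp : ∀ s t x, φ s (φ t x) = φ (s + t) x := by
    intro s t x
    have h := ode_unique_aux (contDiff_hamVF hH₁) (f := fun s => φ s (φ t x))
      (g := fun s => φ (s + t) x) (fun r => hφode r (φ t x))
      (fun r => HasDerivAt.comp_add_const r t (hφode (r + t) x)) (by simp [hφ0])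
    exact congrFun h s
  have hψeq : ψ = fun z => (φ z.2.1 z.1, z.2.1, z.2.2 - H₁ z.1) := by
    funext ⟨x, θ, μ⟩
    exact hψ x θ μ
  have hψs : ContDiff ℝ (⊤ : ℕ∞) ψ := by
    rw [hψeq]
    have h1 : ContDiff ℝ (⊤ : ℕ∞) (fun z : Phase d × ℝ × ℝ => φ z.2.1 z.1) :=
      hφsmooth.comp (f := fun z : Phase d × ℝ × ℝ => (z.2.1, z.1)) (by fun_prop)
    fun_prop
  let ψinv : Phase d × ℝ × ℝ → Phase d × ℝ × ℝ :=
    fun z => (φ (-z.2.1) z.1, z.2.1, z.2.2 + H₁ z.1)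
  have hinvs : ContDiff ℝ (⊤ : ℕ∞) ψinv := by
    have h1 : ContDiff ℝ (⊤ : ℕ∞) (fun z : Phase d × ℝ × ℝ => φ (-z.2.1) z.1) :=
      hφsmooth.comp (f := fun z : Phase d × ℝ × ℝ => (-z.2.1, z.1)) (by fun_prop)
    show ContDiff ℝ (⊤ : ℕ∞) (fun z : Phase d × ℝ × ℝ =>
      (φ (-z.2.1) z.1, z.2.1, z.2.2 + H₁ z.1))
    fun_prop
  have hL : Function.LeftInverse ψinv ψ := by
    rintro ⟨x, θ, μ⟩
    simp [ψinv, hψ, hgrp, hφ0, hE]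
  have hR : Function.RightInverse ψinv ψ := by
    rintro ⟨x, θ, μ⟩
    simp [ψinv, hψ, hgrp, hφ0, hE]
  refine ⟨⟨⟨hL.injective, hR.surjective⟩, hψs, ψinv, hinvs, hL, hR⟩, ?_, ?_, ?_⟩
  · rintro ⟨x, θ, μ⟩ ξ η
    have hA : HasFDerivAt (φ θ) (fderiv ℝ (φ θ) x) x := by
      have h := (hφd (θ, x)).comp x
        (g := fun p : ℝ × Phase d => φ p.1 p.2) (f := fun y => (θ, y)) (by fun_prop)
      exact DifferentiableAt.hasFDerivAt h
    have hF := (hφd (θ, x)).hasFDerivAt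
    set F := fderiv ℝ (fun p : ℝ × Phase d => φ p.1 p.2) (θ, x) with hFdef
    have hF1 : ∀ a u, F (a, u) = a • hamVF H₁ (φ θ x) + fderiv ℝ (φ θ) x u := by
      intro a u
      have e1 : F (1, 0) = hamVF H₁ (φ θ x) := by
        have h := hF.comp_hasDerivAt θ ((hasDerivAt_id θ).prodMk (hasDerivAt_const θ x))
        exact h.unique (hφode θ x)
      have e2 : F (0, u) = fderiv ℝ (φ θ) x u := by
        have h := hF.comp x ((hasFDerivAt_const θ x).prodMk (hasFDerivAt_id x))
        have h' := hA.unique h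
        rw [h']
        simp
      have : ((a, u) : ℝ × Phase d) = a • (1, 0) + (0, u) := by simp
      rw [this, map_add, map_smul, e1, e2]
    have hH' : ∀ u, fderiv ℝ H₁ (φ θ x) (fderiv ℝ (φ θ) x u) = fderiv ℝ H₁ x u := by
      intro u
      have h := (hHd (φ θ x)).hasFDerivAt.comp x hA
      have he : H₁ ∘ φ θ = H₁ := funext fun y => hE θ y
      rw [he] at h
      rw [h.fderiv]
      rfl
    have hD : ∀ ζ : Phase d × ℝ × ℝ, fderiv ℝ ψ (x, θ, μ) ζ =
        (ζ.2.1 • hamVF H₁ (φ θ x) + fderiv ℝ (φ θ) x ζ.1, ζ.2.1,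
          ζ.2.2 - fderiv ℝ H₁ x ζ.1) := by
      intro ζ
      have p1 : HasFDerivAt (fun z : Phase d × ℝ × ℝ => z.1)
        (ContinuousLinearMap.fst ℝ _ _) (x, θ, μ) := hasFDerivAt_fst
      have p2 : HasFDerivAt (fun z : Phase d × ℝ × ℝ => z.2)
        (ContinuousLinearMap.snd ℝ _ _) (x, θ, μ) := hasFDerivAt_snd
      have q1 := p2.fst
      have q2 := p2.snd
      have c1 := HasFDerivAt.comp (x, θ, μ) (g := fun p : ℝ × Phase d => φ p.1 p.2)
        (f := fun z : Phase d × ℝ × ℝ => (z.2.1, z.1)) hF (q1.prodMk p1)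
      have c2 := HasFDerivAt.comp (x, θ, μ) (g := H₁)
        (f := fun z : Phase d × ℝ × ℝ => z.1) (hHd x).hasFDerivAt p1
      have c := c1.prodMk (q1.prodMk (q2.sub c2))
      have hc := c.congr_of_eventuallyEq (f₁ := ψ) (Filter.EventuallyEq.of_eq hψeq)
      rw [hc.fderiv, ← hF1]
      rfl
    rw [hD, hD]
    unfold OmegaP
    simp only
    have hr : ∀ w a v, omega0 w (a • hamVF H₁ (φ θ x) + v)
        = - (a * fderiv ℝ H₁ (φ θ x) w) + omega0 w v := by
      intro w a v
      rw [omega0_swap, omega0_add_left, omega0_smul_left, omega0_hamVF, omega0_swap v w]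
      ring
    have hXX : fderiv ℝ H₁ (φ θ x) (hamVF H₁ (φ θ x)) = 0 := by
      rw [← omega0_hamVF]
      have := omega0_swap (hamVF H₁ (φ θ x)) (hamVF H₁ (φ θ x))
      linarith
    rw [hr, omega0_add_left, omega0_smul_left, omega0_hamVF, hφsymp, map_add, map_smul,
      hXX, hH', hH', smul_eq_mul]
    ring
  · rintro ⟨x, θ, μ⟩
    simp [hψ, hE]
  · intro x θ μ
    rw [hE]
    ring
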